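/- Let s > 0 and d ∈ N. Then a_n(I_d : H^{s,2}(T^d) → L₂(T^d)) ≤ (32e/d)^{s/2} · n^{−s/d} for all n ≥ 9^d e^{d/2}, and a_n(I_d : H^{s,2}(T^d) → L₂(T^d)) ≥ (1/(e(d+2)))^{s/2} · n^{−s/d} for all n ≥ 11^d e^{d/2}. -/

import Mathlib

open MeasureTheory Filter
open scoped ENNReal NNReal

noncomputable section

/-- The index lattice `ℤ^d`. -/
abbrev ZLat (d : ℕ) := Fin d → ℤ

instance fact_two_pi_pos : Fact (0 < 2 * Real.pi) := ⟨by positivity⟩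

/-- The `d`-dimensional torus `𝕋^d = [0,2π]^d` with endpoints identified. -/
abbrev Torus (d : ℕ) := Fin d → AddCircle (2 * Real.pi)

/-- The normalized Lebesgue measure `(2π)^{-d} dx` on the `d`-torus. -/
def torusMeasure (d : ℕ) : Measure (Torus d) :=
  ((ENNReal.ofReal (2 * Real.pi))⁻¹) ^ d • Measure.pi fun _ => volume

/-- The character `e^{i k·x}` on the `d`-torus. -/
def torusChar {d : ℕ} (k : ZLat d) (x : Torus d) : ℂ :=
  ∏ j, fourier (k j) (x j)

/-- The `k`-th Fourier coefficient `f̂(k) = (2π)^{-d} ∫_{𝕋^d} f(x) e^{-i k·x} dx`. -/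
def fourierCoef {d : ℕ} (f : Torus d → ℂ) (k : ZLat d) : ℂ :=
  ∫ x, (starRingEnd ℂ) (torusChar k x) * f x ∂(torusMeasure d)

/-- The `n`-th approximation number of a bounded linear operator `T`:
`a_n(T) = inf {‖T - A‖ : rank A < n}`. -/
def approxNum {X Y : Type*} [NormedAddCommGroup X] [NormedSpace ℂ X]
    [NormedAddCommGroup Y] [NormedSpace ℂ Y] (T : X →L[ℂ] Y) (n : ℕ) : ℝ :=
  sInf {c : ℝ | ∃ A : X →L[ℂ] Y,
    Module.rank ℂ (LinearMap.range (A : X →ₗ[ℂ] Y)) < n ∧ c = ‖T - A‖}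

/-- `ℓ²(ℤ^d)`; an isometric model of the Hilbert space `F_d(w)` via `f ↦ (w(k)·f̂(k))_k`.
Under this identification the embedding `I_d : F_d(w) → G` is characterized by the
property that the function `T c` has Fourier coefficients `c(k)/w(k)`. -/
abbrev ellTwo (d : ℕ) := lp (fun _ : ZLat d => ℂ) 2

/-- `ℓ¹(ℤ^d)`; an isometric model of the Wiener algebra `A(𝕋^d)` via `f ↦ (f̂(k))_k`. -/
abbrev ellOne (d : ℕ) := lp (fun _ : ZLat d => ℂ) 1

/-- `ℓ^∞(ℤ^d)`; an isometric model of the space `ℬ(𝕋^d)` of distributions with bounded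
Fourier coefficients. -/
abbrev ellInfty (d : ℕ) := lp (fun _ : ZLat d => ℂ) ⊤

/-- The weight `w_{s,r}(k) = (1 + ∑_j |k_j|^r)^{s/r}` of the isotropic Sobolev space
`H^{s,r}(𝕋^d) = F_d(w_{s,r})`. -/
def wIso (d : ℕ) (s r : ℝ) (k : ZLat d) : ℝ := (1 + ∑ j, |(k j : ℝ)| ^ r) ^ (s / r)

/-! ### Approximation numbers of diagonal operators -/

section Diagonal

variable {ι Y : Type} [NormedAddCommGroup Y] [InnerProductSpace ℂ Y]

lemma approxNum_le {X Y : Type*} [NormedAddCommGroup X] [NormedSpace ℂ X]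
    [NormedAddCommGroup Y] [NormedSpace ℂ Y] {T A : X →L[ℂ] Y} {n : ℕ}
    (hA : Module.rank ℂ (LinearMap.range (A : X →ₗ[ℂ] Y)) < n) : approxNum T n ≤ ‖T - A‖ :=
  csInf_le ⟨0, by rintro _ ⟨B, -, rfl⟩; exact norm_nonneg _⟩ ⟨A, hA, rfl⟩

lemma le_approxNum {X Y : Type*} [NormedAddCommGroup X] [NormedSpace ℂ X]
    [NormedAddCommGroup Y] [NormedSpace ℂ Y] {T : X →L[ℂ] Y} {n : ℕ} (hn : 0 < n) {ε : ℝ}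
    (h : ∀ A : X →L[ℂ] Y, Module.rank ℂ (LinearMap.range (A : X →ₗ[ℂ] Y)) < n → ε ≤ ‖T - A‖) :
    ε ≤ approxNum T n := by
  refine le_csInf ⟨_, 0, ?_, rfl⟩ ?_
  · simpa using hn
  · rintro _ ⟨A, hA, rfl⟩
    exact h A hA

lemma hasSum_norm_sq (c : lp (fun _ : ι => ℂ) 2) :
    HasSum (fun k => ‖c k‖ ^ 2) (‖c‖ ^ 2) := by
  have := lp.hasSum_norm (p := 2) (by simp) c
  simpa using this

lemma hasSum_norm_sq_repr (b : HilbertBasis ι ℂ Y) (y : Y) :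
    HasSum (fun k => ‖b.repr y k‖ ^ 2) (‖y‖ ^ 2) := by
  simpa using hasSum_norm_sq (b.repr y)

/-- The approximation numbers of a diagonal operator are at most `ε` as soon as fewer than `n`
of its diagonal entries exceed `ε`. -/
lemma approxNum_diagonal_le (b : HilbertBasis ι ℂ Y) (T : lp (fun _ : ι => ℂ) 2 →L[ℂ] Y)
    (m : ι → ℂ) (hT : ∀ c k, b.repr (T c) k = c k * m k) {ε : ℝ} (hε : 0 ≤ ε) (F : Finset ι)
    (hF : ∀ k ∉ F, ‖m k‖ ≤ ε) {n : ℕ} (hn : F.card < n) : approxNum T n ≤ ε := by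
  classical
  let A : lp (fun _ : ι => ℂ) 2 →L[ℂ] Y :=
    ∑ k ∈ F, (lp.evalCLM ℂ (fun _ : ι => ℂ) 2 k).smulRight (m k • b k)
  have hA (c) : A c = ∑ k ∈ F, c k • m k • b k := by
    simp [A, lp.evalCLM]
  have hrepr (c k) : b.repr ((T - A) c) k = if k ∈ F then 0 else c k * m k := by
    have : b.repr (A c) k = if k ∈ F then c k * m k else 0 := by
      rw [b.repr_apply_apply, hA, inner_sum]
      simp only [inner_smul_right, orthonormal_iff_ite.mp b.orthonormal k, mul_ite, mul_one,
        mul_zero, Finset.sum_ite_eq]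
    rw [sub_apply, map_sub, lp.coeFn_sub, Pi.sub_apply, this, hT]
    split_ifs <;> simp
  refine (approxNum_le (A := A) ?_).trans (ContinuousLinearMap.opNorm_le_bound _ hε fun c => ?_)
  · have hle : LinearMap.range (A : lp (fun _ : ι => ℂ) 2 →ₗ[ℂ] Y) ≤
        Submodule.span ℂ ((F.image b : Finset Y) : Set Y) := by
      rintro _ ⟨c, rfl⟩
      rw [ContinuousLinearMap.coe_coe, hA]
      refine Submodule.sum_mem _ fun k hk => Submodule.smul_mem _ _ (Submodule.smul_mem _ _
        (Submodule.subset_span (Finset.mem_coe.2 (Finset.mem_image_of_mem _ hk))))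
    refine ((Submodule.rank_mono hle).trans (rank_span_finset_le _)).trans_lt ?_
    exact_mod_cast Finset.card_image_le.trans_lt hn
  · refine (pow_le_pow_iff_left₀ (norm_nonneg _) (by positivity) two_ne_zero).1 ?_
    rw [mul_pow]
    refine hasSum_le (fun k => ?_) (hasSum_norm_sq_repr b _)
      ((hasSum_norm_sq c).mul_left (ε ^ 2))
    rw [hrepr, ← mul_pow]
    gcongr
    split_ifs with hk
    · simpa using by positivity
    · rw [norm_mul, mul_comm]
      gcongr
      exact hF k hk

/-- The `n`-th approximation number of a diagonal operator is at least `ε` as soon as `n`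
of its diagonal entries are at least `ε` in modulus. -/
lemma le_approxNum_diagonal (b : HilbertBasis ι ℂ Y) (T : lp (fun _ : ι => ℂ) 2 →L[ℂ] Y)
    (m : ι → ℂ) (hT : ∀ c k, b.repr (T c) k = c k * m k) {ε : ℝ} (hε : 0 ≤ ε) (F : Finset ι)
    (hF : ∀ k ∈ F, ε ≤ ‖m k‖) {n : ℕ} (hn₀ : 0 < n) (hn : n ≤ F.card) : ε ≤ approxNum T n := by
  classical
  refine le_approxNum hn₀ fun A hA => ?_
  let E : (F → ℂ) →ₗ[ℂ] lp (fun _ : ι => ℂ) 2 :=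
    ∑ k : F, (lp.lsingle (𝕜 := ℂ) (E := fun _ : ι => ℂ) 2 (k : ι)).comp (LinearMap.proj k)
  have hE (x : F → ℂ) (j : ι) : E x j = if h : j ∈ F then x ⟨j, h⟩ else 0 := by
    have : E x j = ∑ k : F, (Pi.single (k : ι) (x k) : ι → ℂ) j := by
      rw [LinearMap.sum_apply, lp.coeFn_sum, Finset.sum_apply]
      rfl
    rw [this]
    split_ifs with h
    · rw [Finset.sum_eq_single ⟨j, h⟩]
      · simp
      · intro k _ hk
        exact Pi.single_eq_of_ne (fun h' => hk (Subtype.ext h'.symm)) _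
      · simp
    · refine Finset.sum_eq_zero fun k _ => Pi.single_eq_of_ne ?_ _
      rintro rfl
      exact h k.2
  let L := (A : lp (fun _ : ι => ℂ) 2 →ₗ[ℂ] Y).rangeRestrict.comp E
  have hL : ¬ Function.Injective L := fun h => by
    have := LinearMap.rank_le_of_injective L h
    rw [rank_fun', Fintype.card_coe] at this
    exact absurd (this.trans_lt hA) (by exact_mod_cast hn.not_gt)
  rw [← LinearMap.ker_eq_bot, Submodule.eq_bot_iff] at hL
  push Not at hL
  obtain ⟨x, hx, hx0⟩ := hL
  have hAE : A (E x) = 0 := congrArg Subtype.val (LinearMap.mem_ker.1 hx)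
  have hE0 : 0 < ‖E x‖ := by
    rw [norm_pos_iff]
    intro h
    refine hx0 (funext fun k => ?_)
    have := hE x k
    rw [h] at this
    simpa using this.symm
  have hlow : ε * ‖E x‖ ≤ ‖T (E x)‖ := by
    refine (pow_le_pow_iff_left₀ (by positivity) (norm_nonneg _) two_ne_zero).1 ?_
    rw [mul_pow]
    refine hasSum_le (fun k => ?_) ((hasSum_norm_sq (E x)).mul_left (ε ^ 2))
      (hasSum_norm_sq_repr b _)
    rw [hT, ← mul_pow, norm_mul, mul_comm]
    by_cases hk : k ∈ F
    · gcongr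
      exact hF k hk
    · simp [hE, hk]
  have hup : ‖T (E x)‖ ≤ ‖T - A‖ * ‖E x‖ := by
    simpa [hAE] using (T - A).le_opNorm (E x)
  exact le_of_mul_le_mul_right (hlow.trans hup) hE0

end Diagonal

/-! ### The Fourier basis of the torus -/

section FourierBasis

open AddCircle Submodule

variable {d : ℕ}

lemma torusMeasure_eq_pi_haar (d : ℕ) :
    torusMeasure d =
      Measure.pi fun _ : Fin d => (haarAddCircle : Measure (AddCircle (2 * Real.pi))) := by
  symm
  refine Measure.pi_eq fun s hs => ?_
  have hpos : ENNReal.ofReal (2 * Real.pi) ≠ 0 := by simp [Real.pi_pos]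
  rw [torusMeasure, Measure.smul_apply, Measure.pi_pi]
  simp_rw [volume_eq_smul_haarAddCircle, Measure.smul_apply, smul_eq_mul]
  rw [Finset.prod_mul_distrib, Finset.prod_const, Finset.card_univ, Fintype.card_fin, ← mul_assoc,
    ← mul_pow, ENNReal.inv_mul_cancel hpos ENNReal.ofReal_ne_top, one_pow, one_mul]

instance (d : ℕ) : IsProbabilityMeasure (torusMeasure d) := by
  rw [torusMeasure_eq_pi_haar]
  infer_instance

/-- The character `e^{i k·x}` as a continuous function. -/
def torusCharC (k : ZLat d) : C(Torus d, ℂ) where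
  toFun := torusChar k
  continuous_toFun := by unfold torusChar; fun_prop

lemma torusChar_neg (k : ZLat d) (x : Torus d) :
    torusChar (-k) x = starRingEnd ℂ (torusChar k x) := by
  simp only [torusChar, Pi.neg_apply, fourier_neg, map_prod]

lemma torusChar_add (k l : ZLat d) (x : Torus d) :
    torusChar (k + l) x = torusChar k x * torusChar l x := by
  simp only [torusChar, Pi.add_apply, fourier_add, ← Finset.prod_mul_distrib]

lemma torusChar_zero (x : Torus d) : torusChar 0 x = 1 := by
  simp [torusChar]

lemma torusChar_single (x : Torus d) (i : Fin d) :
    torusChar (Pi.single i 1) x = fourier 1 (x i) := by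
  rw [torusChar, Finset.prod_eq_single i _ (by simp), Pi.single_eq_same]
  intro j _ hj
  rw [Pi.single_eq_of_ne hj, fourier_zero]

/-- The star subalgebra of trigonometric polynomials on the torus. -/
def torusCharSubalgebra (d : ℕ) : StarSubalgebra ℂ C(Torus d, ℂ) where
  toSubalgebra := Algebra.adjoin ℂ (Set.range torusCharC)
  star_mem' := by
    change Algebra.adjoin ℂ (Set.range torusCharC) ≤
      star (Algebra.adjoin ℂ (Set.range torusCharC))
    refine Algebra.adjoin_le ?_
    rintro _ ⟨k, rfl⟩
    refine Algebra.subset_adjoin ⟨-k, ?_⟩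
    ext1 x
    exact torusChar_neg k x

lemma torusCharSubalgebra_coe :
    (torusCharSubalgebra d).toSubalgebra.toSubmodule = span ℂ (Set.range torusCharC) := by
  refine Algebra.adjoin_eq_span_of_subset _ (.trans
    (fun x => Submonoid.closure_induction (fun _ => id) ⟨0, ?_⟩ ?_) subset_span)
  · ext x
    exact torusChar_zero x
  · rintro _ _ _ _ ⟨k, rfl⟩ ⟨l, rfl⟩
    refine ⟨k + l, ?_⟩
    ext x
    exact torusChar_add k l x

lemma torusCharSubalgebra_separatesPoints : (torusCharSubalgebra d).SeparatesPoints := by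
  intro x y hxy
  obtain ⟨i, hi⟩ := Function.ne_iff.mp hxy
  refine ⟨_, ⟨torusCharC (Pi.single i 1), Algebra.subset_adjoin ⟨Pi.single i 1, rfl⟩, rfl⟩, ?_⟩
  change torusChar _ x ≠ torusChar _ y
  rw [torusChar_single, torusChar_single, fourier_one, fourier_one]
  exact fun h => hi (AddCircle.injective_toCircle fact_two_pi_pos.out.ne' (Subtype.ext h))

lemma span_torusCharC_closure_eq_top :
    (span ℂ (Set.range (torusCharC (d := d)))).topologicalClosure = ⊤ := by
  rw [← torusCharSubalgebra_coe]
  exact congr_arg (Subalgebra.toSubmodule <| StarSubalgebra.toSubalgebra ·)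
    (ContinuousMap.starSubalgebra_topologicalClosure_eq_top_of_separatesPoints _
      torusCharSubalgebra_separatesPoints)

/-- The character `e^{i k·x}` as an element of `L²`. -/
abbrev torusCharLp (k : ZLat d) : Lp ℂ 2 (torusMeasure d) :=
  ContinuousMap.toLp (E := ℂ) 2 (torusMeasure d) ℂ (torusCharC k)

instance (d : ℕ) : (torusMeasure d).WeaklyRegular := by
  rw [torusMeasure_eq_pi_haar]
  infer_instance

lemma span_torusCharLp_closure_eq_top :
    (span ℂ (Set.range (torusCharLp (d := d)))).topologicalClosure = ⊤ := by
  simpa only [map_span, ContinuousLinearMap.coe_coe, ← Set.range_comp, Function.comp_def] using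
    (ContinuousMap.toLp_denseRange ℂ (torusMeasure d) ℂ
      (ENNReal.ofNat_ne_top (n := 2))).topologicalClosure_map_submodule span_torusCharC_closure_eq_top

lemma orthonormal_torusCharLp : Orthonormal ℂ (torusCharLp (d := d)) := by
  rw [orthonormal_iff_ite]
  intro k l
  have hin : inner ℂ (torusCharLp k) (torusCharLp l) =
      ∏ i, inner ℂ (fourierLp 2 (k i) : Lp ℂ 2 (haarAddCircle : Measure (AddCircle (2 * Real.pi))))
        (fourierLp 2 (l i)) := by
    simp only [ContinuousMap.inner_toLp]
    rw [torusMeasure_eq_pi_haar, ← integral_fintype_prod_eq_prod]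
    simp only [torusCharC, ContinuousMap.coe_mk, torusChar, map_prod, Finset.prod_mul_distrib]
  rw [hin]
  simp_rw [orthonormal_iff_ite.mp orthonormal_fourier]
  rw [Finset.prod_ite_zero]
  simp [funext_iff]

/-- The characters form a Hilbert basis of `L²` of the torus. -/
def torusBasis (d : ℕ) : HilbertBasis (ZLat d) ℂ (Lp ℂ 2 (torusMeasure d)) :=
  HilbertBasis.mk orthonormal_torusCharLp span_torusCharLp_closure_eq_top.ge

lemma torusBasis_repr (f : Lp ℂ 2 (torusMeasure d)) (k : ZLat d) :
    (torusBasis d).repr f k = fourierCoef f k := by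
  rw [HilbertBasis.repr_apply_apply, torusBasis, HilbertBasis.coe_mk, MeasureTheory.L2.inner_def]
  refine integral_congr_ae ?_
  filter_upwards [ContinuousMap.coeFn_toLp (𝕜 := ℂ) (p := 2) (torusMeasure d) (torusCharC k)]
    with x hx
  rw [hx, RCLike.inner_apply, mul_comm]
  rfl

end FourierBasis

/-! ### Counting lattice points -/

section Counting

lemma sum_range_exp_neg_mul_sq_le {t : ℝ} (ht : 0 < t) (N : ℕ) :
    ∑ i ∈ Finset.range N, Real.exp (-t * ((i : ℝ) + 1) ^ 2) ≤ √(Real.pi / t) / 2 := by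
  have hanti : AntitoneOn (fun x : ℝ => Real.exp (-t * x ^ 2)) (Set.Icc 0 (0 + (N : ℝ))) := by
    intro x hx y _ hxy
    have := pow_le_pow_left₀ hx.1 hxy 2
    exact Real.exp_le_exp.2 (by nlinarith)
  calc ∑ i ∈ Finset.range N, Real.exp (-t * ((i : ℝ) + 1) ^ 2)
      ≤ ∫ x in (0 : ℝ)..(0 + (N : ℝ)), Real.exp (-t * x ^ 2) := by
        simpa using hanti.sum_le_integral
    _ ≤ ∫ x in Set.Ioi (0 : ℝ), Real.exp (-t * x ^ 2) := by
        rw [intervalIntegral.integral_of_le (by positivity)]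
        exact setIntegral_mono_set (integrable_exp_neg_mul_sq ht).integrableOn
          (Eventually.of_forall fun x => (Real.exp_pos _).le)
          Set.Ioc_subset_Ioi_self.eventuallyLE
    _ = √(Real.pi / t) / 2 := integral_gaussian_Ioi t

lemma sum_Icc_neg_exp_neg_mul_sq_le {t : ℝ} (ht : 0 < t) (N : ℕ) :
    ∑ i ∈ Finset.Icc (-(N : ℤ)) N, Real.exp (-t * (i : ℝ) ^ 2) ≤ 1 + √(Real.pi / t) := by
  have h : ∑ i ∈ Finset.Icc (-(N : ℤ)) N, Real.exp (-t * (i : ℝ) ^ 2) =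
      1 + 2 * ∑ i ∈ Finset.range N, Real.exp (-t * ((i : ℝ) + 1) ^ 2) := by
    induction N with
    | zero => simp
    | succ N ih =>
      rw [Finset.sum_range_succ, Nat.cast_succ, Finset.sum_Icc_succ_eq_add_endpoints, ih]
      push_cast
      ring_nf
  rw [h]
  linarith [sum_range_exp_neg_mul_sq_le ht N]

/-- Chernoff-type bound for the number of lattice points in a ball intersected with a cube. -/
lemma card_filter_sum_sq_lt_le (d N : ℕ) {t : ℝ} (ht : 0 < t) (M : ℝ) :
    (((Fintype.piFinset fun _ : Fin d => Finset.Icc (-(N : ℤ)) N).filter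
      fun k => 1 + ∑ j, (k j : ℝ) ^ 2 < M).card : ℝ) ≤
      Real.exp (t * M) * (1 + √(Real.pi / t)) ^ d := by
  calc _ = ∑ k ∈ (Fintype.piFinset fun _ : Fin d => Finset.Icc (-(N : ℤ)) N).filter
            fun k => 1 + ∑ j, (k j : ℝ) ^ 2 < M, (1 : ℝ) := by simp
    _ ≤ ∑ k ∈ (Fintype.piFinset fun _ : Fin d => Finset.Icc (-(N : ℤ)) N).filter
            fun k => 1 + ∑ j, (k j : ℝ) ^ 2 < M,
          Real.exp (t * M) * ∏ j, Real.exp (-t * (k j : ℝ) ^ 2) := by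
        refine Finset.sum_le_sum fun k hk => ?_
        rw [← Real.exp_sum, ← Real.exp_add, ← Finset.mul_sum]
        have := (Finset.mem_filter.1 hk).2
        exact Real.one_le_exp (by nlinarith)
    _ ≤ ∑ k ∈ Fintype.piFinset fun _ : Fin d => Finset.Icc (-(N : ℤ)) N,
          Real.exp (t * M) * ∏ j, Real.exp (-t * (k j : ℝ) ^ 2) :=
        Finset.sum_le_sum_of_subset_of_nonneg (Finset.filter_subset _ _)
          fun _ _ _ => by positivity
    _ = Real.exp (t * M) *
          (∑ i ∈ Finset.Icc (-(N : ℤ)) N, Real.exp (-t * (i : ℝ) ^ 2)) ^ d := by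
        rw [← Finset.mul_sum,
          Finset.sum_prod_piFinset _ fun _ (i : ℤ) => Real.exp (-t * (i : ℝ) ^ 2),
          Finset.prod_const, Finset.card_univ, Fintype.card_fin]
    _ ≤ _ := by
        gcongr
        exact sum_Icc_neg_exp_neg_mul_sq_le ht N

/-- Fewer than `x ^ d` lattice points have weight `1 + |k|²` below `d x² / (32 e)`. -/
lemma exists_finset_card_lt {d : ℕ} (hd : 0 < d) {x : ℝ} (hx : 9 * Real.exp (1 / 2) ≤ x) :
    ∃ F : Finset (ZLat d), (F.card : ℝ) < x ^ d ∧
      ∀ k ∉ F, d * x ^ 2 / (32 * Real.exp 1) ≤ 1 + ∑ j, (k j : ℝ) ^ 2 := by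
  have he : 0 < Real.exp (1 / 2) := Real.exp_pos _
  have hx0 : 0 < x := by linarith
  have hd0 : (0 : ℝ) < d := by exact_mod_cast hd
  set M : ℝ := d * x ^ 2 / (32 * Real.exp 1) with hM
  obtain ⟨N, hN⟩ := exists_nat_ge M
  have hee : Real.exp 1 = Real.exp (1 / 2) ^ 2 := by rw [← Real.exp_nat_mul]; norm_num
  let t : ℝ := 16 * Real.exp 1 / x ^ 2
  have ht : 0 < t := by positivity
  refine ⟨_, (card_filter_sum_sq_lt_le d N ht M).trans_lt ?_, fun k hk => ?_⟩
  · have htM : t * M = d * (1 / 2) := by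
      simp only [t, M]
      field_simp
      norm_num
    rw [htM, Real.exp_nat_mul, ← mul_pow]
    refine pow_lt_pow_left₀ ?_ (by positivity) hd.ne'
    have hsq : √(Real.pi / t) ≤ x / (2 * Real.exp (1 / 2)) := by
      rw [Real.sqrt_le_left (by positivity)]
      simp only [t]
      rw [hee, div_pow, mul_pow, div_div_eq_mul_div, div_le_div_iff₀ (by positivity) (by positivity)]
      have := Real.pi_le_four
      have h0 : 0 ≤ x ^ 2 * Real.exp (1 / 2) ^ 2 := by positivity
      nlinarith
    have : Real.exp (1 / 2) * √(Real.pi / t) ≤ x / 2 := by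
      calc _ ≤ Real.exp (1 / 2) * (x / (2 * Real.exp (1 / 2))) := by gcongr
        _ = x / 2 := by field_simp
    linarith
  · by_contra! hlt
    refine hk (Finset.mem_filter.2 ⟨Fintype.mem_piFinset.2 fun j => ?_, hlt⟩)
    have h1 : (k j : ℝ) ^ 2 ≤ ∑ j, (k j : ℝ) ^ 2 :=
      Finset.single_le_sum (f := fun j => (k j : ℝ) ^ 2) (fun _ _ => sq_nonneg _)
        (Finset.mem_univ j)
    have h2 : (k j) ^ 2 ≤ (N : ℤ) := by
      have : (k j : ℝ) ^ 2 ≤ N := by linarith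
      exact_mod_cast this
    rw [Finset.mem_Icc]
    constructor <;> nlinarith [Int.le_self_sq (k j), Int.le_self_sq (-(k j))]

/-- At least `x ^ d` lattice points have weight `1 + |k|²` at most `e (d + 2) x²`. -/
lemma exists_finset_le_card (d : ℕ) {x : ℝ} (hx : 1 ≤ x) :
    ∃ F : Finset (ZLat d), x ^ d ≤ F.card ∧
      ∀ k ∈ F, 1 + ∑ j, (k j : ℝ) ^ 2 ≤ Real.exp 1 * (d + 2) * x ^ 2 := by
  have hx0 : 0 ≤ x := by linarith
  refine ⟨Fintype.piFinset fun _ => Finset.Icc (-(⌊x⌋₊ : ℤ)) ⌊x⌋₊, ?_, fun k hk => ?_⟩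
  · have hcard : (Finset.Icc (-(⌊x⌋₊ : ℤ)) ⌊x⌋₊).card = 2 * ⌊x⌋₊ + 1 := by
      rw [Int.card_Icc]
      omega
    rw [Fintype.card_piFinset_const, hcard]
    push_cast
    gcongr
    linarith [Nat.lt_floor_add_one x, Nat.cast_nonneg (α := ℝ) ⌊x⌋₊]
  · have hsum : ∑ j, (k j : ℝ) ^ 2 ≤ ∑ _j : Fin d, x ^ 2 := by
      refine Finset.sum_le_sum fun j _ => ?_
      have h := Finset.mem_Icc.1 (Fintype.mem_piFinset.1 hk j)
      have h1 : -(⌊x⌋₊ : ℝ) ≤ k j := by exact_mod_cast h.1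
      have h2 : (k j : ℝ) ≤ ⌊x⌋₊ := by exact_mod_cast h.2
      have := Nat.floor_le hx0
      exact sq_le_sq' (by linarith) (by linarith)
    rw [Finset.sum_const, Finset.card_univ, Fintype.card_fin, nsmul_eq_mul] at hsum
    have he : 1 ≤ Real.exp 1 := Real.one_le_exp zero_le_one
    have hd : (0 : ℝ) ≤ d := Nat.cast_nonneg d
    have hx2 : 1 ≤ x ^ 2 := one_le_pow₀ hx
    have : 1 * ((d + 2) * x ^ 2) ≤ Real.exp 1 * ((d + 2) * x ^ 2) := by gcongr
    nlinarith

end Counting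

lemma norm_inv_wIso (d : ℕ) (s : ℝ) (k : ZLat d) :
    ‖((wIso d s 2 k : ℂ))⁻¹‖ = (1 / (1 + ∑ j, (k j : ℝ) ^ 2)) ^ (s / 2) := by
  have h : (0 : ℝ) ≤ 1 + ∑ j, (k j : ℝ) ^ 2 := by positivity
  have hw : wIso d s 2 k = (1 + ∑ j, (k j : ℝ) ^ 2) ^ (s / 2) := by simp [wIso]
  rw [norm_inv, hw, Complex.norm_real, Real.norm_of_nonneg (by positivity), one_div,
    Real.inv_rpow h]

/-- Rewriting the asymptotic bound in terms of `x = n ^ (1 / d)`. -/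
lemma rpow_mul_rpow_neg_div {d : ℕ} (hd : 0 < d) (s : ℝ) {a x : ℝ} (ha : 0 ≤ a) (hx : 0 < x) :
    a ^ (s / 2) * (x ^ d) ^ (-(s / (d : ℝ))) = (a / x ^ 2) ^ (s / 2) := by
  have hd0 : (d : ℝ) ≠ 0 := by exact_mod_cast hd.ne'
  rw [Real.div_rpow ha (by positivity), ← Real.rpow_natCast x d, ← Real.rpow_natCast x 2,
    ← Real.rpow_mul hx.le, ← Real.rpow_mul hx.le, div_eq_mul_inv (a ^ (s / 2)),
    ← Real.rpow_neg hx.le]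
  congr 2
  push_cast
  field_simp

lemma exists_root_of_le {d : ℕ} (hd : 0 < d) {c : ℝ} (hc : 0 < c) {n : ℕ}
    (hn : c ^ d * Real.exp ((d : ℝ) / 2) ≤ n) :
    ∃ x : ℝ, c * Real.exp (1 / 2) ≤ x ∧ x ^ d = n := by
  refine ⟨(n : ℝ) ^ (d : ℝ)⁻¹, ?_, Real.rpow_inv_natCast_pow (Nat.cast_nonneg n) hd.ne'⟩
  refine (pow_le_pow_iff_left₀ (by positivity) (by positivity) hd.ne').1 ?_
  rw [Real.rpow_inv_natCast_pow (Nat.cast_nonneg n) hd.ne', mul_pow, ← Real.exp_nat_mul,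
    mul_one_div]
  exact hn

/-- Proposition 5 of Cobos–Kühn–Sickel. For `s > 0` and `d ∈ ℕ`,
`a_n(I_d : H^{s,2}(𝕋^d) → L₂(𝕋^d)) ≤ (32e/d)^{s/2} n^{-s/d}` for `n ≥ 9^d e^{d/2}`,
and `a_n(I_d : H^{s,2}(𝕋^d) → L₂(𝕋^d)) ≥ (1/(e(d+2)))^{s/2} n^{-s/d}` for
`n ≥ 11^d e^{d/2}`. -/
theorem statement7 (d : ℕ) (hd : 0 < d) (s : ℝ) (hs : 0 < s)
    (T : ellTwo d →L[ℂ] Lp ℂ 2 (torusMeasure d))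
    (hT : ∀ (c : ellTwo d) (k : ZLat d), fourierCoef (⇑(T c)) k = c k / (wIso d s 2 k : ℂ)) :
    (∀ n : ℕ, (9 : ℝ) ^ d * Real.exp ((d : ℝ) / 2) ≤ (n : ℝ) →
      approxNum T n ≤
        (32 * Real.exp 1 / (d : ℝ)) ^ (s / 2) * (n : ℝ) ^ (-(s / (d : ℝ)))) ∧
    (∀ n : ℕ, (11 : ℝ) ^ d * Real.exp ((d : ℝ) / 2) ≤ (n : ℝ) →
      (1 / (Real.exp 1 * ((d : ℝ) + 2))) ^ (s / 2) * (n : ℝ) ^ (-(s / (d : ℝ))) ≤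
        approxNum T n) := by
  have hrepr (c : ellTwo d) (k : ZLat d) :
      (torusBasis d).repr (T c) k = c k * (wIso d s 2 k : ℂ)⁻¹ := by
    rw [torusBasis_repr, hT, div_eq_mul_inv]
  have hd0 : (0 : ℝ) < d := by exact_mod_cast hd
  have he : 1 ≤ Real.exp (1 / 2) := Real.one_le_exp (by norm_num)
  refine ⟨fun n hn => ?_, fun n hn => ?_⟩
  · obtain ⟨x, hx, hxn⟩ := exists_root_of_le hd (by norm_num) hn
    have hx0 : 0 < x := by linarith
    obtain ⟨F, hcard, hF⟩ := exists_finset_card_lt hd hx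
    rw [← hxn, rpow_mul_rpow_neg_div hd s (by positivity) hx0]
    refine approxNum_diagonal_le (torusBasis d) T _ hrepr (by positivity) F (fun k hk => ?_) ?_
    · rw [norm_inv_wIso]
      refine Real.rpow_le_rpow (by positivity) ?_ (by positivity)
      rw [div_div, ← one_div_div (d * x ^ 2 : ℝ)]
      exact one_div_le_one_div_of_le (by positivity) (hF k hk)
    · rw [hxn] at hcard
      exact_mod_cast hcard
  · obtain ⟨x, hx, hxn⟩ := exists_root_of_le hd (by norm_num) hn
    have hx1 : 1 ≤ x := by linarith
    obtain ⟨F, hcard, hF⟩ := exists_finset_le_card d hx1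
    have hn0 : 0 < n := by
      have : (0 : ℝ) < n := hxn ▸ by positivity
      exact_mod_cast this
    rw [← hxn, rpow_mul_rpow_neg_div hd s (by positivity) (by linarith)]
    refine le_approxNum_diagonal (torusBasis d) T _ hrepr (by positivity) F (fun k hk => ?_) hn0 ?_
    · rw [norm_inv_wIso]
      refine Real.rpow_le_rpow (by positivity) ?_ (by positivity)
      rw [div_div]
      exact one_div_le_one_div_of_le (by positivity) (hF k hk)
    · rw [hxn] at hcard
      exact_mod_cast hcard
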